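/- Let P = (ω^ω, ρ, x̄) be any presentation of Baire space ω^ω where ρ is the standard ultrametric. Then there exists a countable closed F ⊆ ω^ω with φ_P(F) = 2 such that for every countable ordinal α with 2 ≤ α there is a homeomorphism f_α : ω^ω → ω^ω with φ_{P_{f_α}}(F) = α, where P_{f_α} = (ω^ω, ρ_{f_α}, ȳ) is the presentation with ρ_{f_α}(x, y) = ρ(f_α(x), f_α(y)) and y_i = f_α^{-1}(x_i). -/

import Mathlib

open Set Filter Topology

/-- A presentation `(X, d, x̄)` of a Polish space `X`: a complete metric `d`
compatible with the topology of `X`, together with a dense sequence `x̄`. -/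
structure Presentation (X : Type) [TopologicalSpace X] where
  dist : X → X → ℝ
  seq : ℕ → X
  dist_self : ∀ x, dist x x = 0
  eq_of_dist_eq_zero : ∀ x y, dist x y = 0 → x = y
  dist_comm : ∀ x y, dist x y = dist y x
  dist_triangle : ∀ x y z, dist x z ≤ dist x y + dist y z
  /-- `d` is compatible with the topology of `X`. -/
  isOpen_iff : ∀ s : Set X, IsOpen s ↔ ∀ x ∈ s, ∃ ε > 0, ∀ y, dist y x < ε → y ∈ s
  /-- `d` is complete. -/
  complete : ∀ u : ℕ → X, (∀ ε > 0, ∃ N, ∀ m ≥ N, ∀ n ≥ N, dist (u m) (u n) < ε) →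
      ∃ x, ∀ ε > 0, ∃ N, ∀ n ≥ N, dist (u n) x < ε
  /-- the sequence `x̄` is dense. -/
  dense : ∀ x, ∀ ε > 0, ∃ i, dist x (seq i) < ε

namespace Presentation

variable {X : Type} [TopologicalSpace X] (P : Presentation X)

/-- The open ball `B_P(n)`. -/
def ball (n : ℕ × ℕ) : Set X := {x | P.dist x (P.seq n.1) < (1/2 : ℝ) ^ (n.2 + 1)}

/-- The closed ball `B̄_P(n)`. -/
def cball (n : ℕ × ℕ) : Set X := {x | P.dist x (P.seq n.1) ≤ (1/2 : ℝ) ^ (n.2 + 1)}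

/-- The relation `n ≺_P m`. -/
def prec (n m : ℕ × ℕ) : Prop := n.2 < m.2 ∧ P.cball m ⊆ P.ball n

/-- The relation `n ⋏_P m`. -/
def apart (n m : ℕ × ℕ) : Prop := P.cball n ∩ P.cball m = ∅

/-- The code `A_F^P` of a closed set `F ⊆ X`. -/
def code (F : Set X) : Set (ℕ × ℕ) := {n | (P.ball n ∩ F).Nonempty}

/-- The derivative `D_P` on subsets of `ω × ω`. -/
def deriv (A : Set (ℕ × ℕ)) : Set (ℕ × ℕ) :=
  {n ∈ A | ∃ u ∈ A, ∃ v ∈ A, P.prec n u ∧ P.prec n v ∧ P.apart u v}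

/-- The transfinite iterates `D_P^α(A)`. -/
noncomputable def derivIter (A : Set (ℕ × ℕ)) (α : Ordinal.{0}) : Set (ℕ × ℕ) :=
  Ordinal.limitRecOn α A (fun _ ih => P.deriv ih)
    (fun o _ ih => ⋂ (β : {β : Ordinal.{0} // β < o}), ih β.1 β.2)

/-- The rank `|A|_P`: the least ordinal `α` with `D_P^α(A) = D_P^{α+1}(A)`. -/
noncomputable def rankA (A : Set (ℕ × ℕ)) : Ordinal.{0} :=
  sInf {α | P.derivIter A (α + 1) = P.derivIter A α}

/-- The rank `φ_P(F) = |A_F^P|_P` of a (countable closed) subset `F ⊆ X`. -/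
noncomputable def phi (F : Set X) : Ordinal.{0} := P.rankA (P.code F)

/-- `A ⊆ ω × ω` is `P`-closed. -/
def PClosed (A : Set (ℕ × ℕ)) : Prop := ∀ n ∈ A, ∀ m, P.prec m n → m ∈ A

/-- `A ⊆ ω × ω` is `P`-pruned. -/
def PPruned (A : Set (ℕ × ℕ)) : Prop := ∀ n ∈ A, ∃ m ∈ A, P.prec n m

/-- `A ⊆ ω × ω` is `P`-perfect. -/
def PPerfect (A : Set (ℕ × ℕ)) : Prop :=
  ∀ n ∈ A, ∃ u ∈ A, ∃ v ∈ A, P.prec n u ∧ P.prec n v ∧ P.apart u v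

/-- The set `[A]_P` of `P`-compatible sequences lying in `A`. -/
def body (A : Set (ℕ × ℕ)) : Set (ℕ → ℕ × ℕ) :=
  {f | (∀ i, P.prec (f i) (f (i + 1))) ∧ ∀ i, f i ∈ A}

/-- The set `F_A^P = π_P([A]_P)`: the points obtained as the unique point of
`⋂_i B_P(n_i)` for a `P`-compatible sequence `(n_i)` in `A`. -/
def limitSet (A : Set (ℕ × ℕ)) : Set X :=
  {x | ∃ f ∈ P.body A, ∀ i, x ∈ P.ball (f i)}

end Presentation

section CB

variable {X : Type} [TopologicalSpace X]

/-- The Cantor–Bendixson derivative: the set of limit points of `F` in `F`. -/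
def cbDeriv (F : Set X) : Set X := {x ∈ F | AccPt x (𝓟 F)}

/-- The iterated Cantor–Bendixson derivatives `F^α`. -/
noncomputable def cbIter (F : Set X) (α : Ordinal.{0}) : Set X :=
  Ordinal.limitRecOn α F (fun _ ih => cbDeriv ih)
    (fun o _ ih => ⋂ (β : {β : Ordinal.{0} // β < o}), ih β.1 β.2)

/-- The Cantor–Bendixson rank `|F|_CB`. -/
noncomputable def cbRank (F : Set X) : Ordinal.{0} :=
  sInf {α | cbIter F (α + 1) = cbIter F α}

/-- The `K_σ`-derivative of a subset `A ⊆ X`: the points of `A` having no open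
neighborhood in the subspace `A` whose closure in `A` is compact. -/
def kDeriv (A : Set X) : Set X :=
  {x ∈ A | ∀ U : Set X, IsOpen U → x ∈ U → ¬ IsCompact (A ∩ closure (U ∩ A))}

/-- The iterated `K_σ`-derivatives `X_α` of the space `X`. -/
noncomputable def kIter (X : Type) [TopologicalSpace X] (α : Ordinal.{0}) : Set X :=
  Ordinal.limitRecOn α Set.univ (fun _ ih => kDeriv ih)
    (fun o _ ih => ⋂ (β : {β : Ordinal.{0} // β < o}), ih β.1 β.2)

/-- The `K_σ`-rank `|X|_{K_σ}`. -/
noncomputable def kRank (X : Type) [TopologicalSpace X] : Ordinal.{0} :=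
  sInf {α | kIter X (α + 1) = kIter X α}

end CB

open Classical in
/-- The standard ultrametric on Baire space `ℕ → ℕ`:
`ρ(x,y) = 2^{-min{n : x n ≠ y n} - 1}` for `x ≠ y`, and `0` otherwise. -/
noncomputable def baireDist (x y : ℕ → ℕ) : ℝ :=
  if h : x = y then 0
  else (1 / 2 : ℝ) ^ (Nat.find (show ∃ n, x n ≠ y n by
    by_contra hc
    push_neg at hc
    exact h (funext hc)) + 1)

section BaireDist

theorem baireDist_lt_iff (x y : ℕ → ℕ) (n : ℕ) :
    baireDist x y < (1 / 2 : ℝ) ^ (n + 1) ↔ ∀ j < n + 1, x j = y j := by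
  unfold baireDist
  split_ifs with h
  · subst h; simp
  · rw [pow_lt_pow_iff_right_of_lt_one₀ (by norm_num) (by norm_num), add_lt_add_iff_right,
      Nat.lt_find_iff]
    simp

theorem baireDist_le_iff (x y : ℕ → ℕ) (n : ℕ) :
    baireDist x y ≤ (1 / 2 : ℝ) ^ (n + 1) ↔ ∀ j < n, x j = y j := by
  unfold baireDist
  split_ifs with h
  · subst h; simp
  · rw [pow_le_pow_iff_right_of_lt_one₀ (by norm_num) (by norm_num), add_le_add_iff_right,
      Nat.le_find_iff]
    simp

end BaireDist

namespace Presentation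

section Iterates

variable {X : Type} [TopologicalSpace X] (P : Presentation X) (A : Set (ℕ × ℕ))

theorem derivIter_zero : P.derivIter A 0 = A := by
  simp [derivIter]

theorem derivIter_add_one (α : Ordinal.{0}) :
    P.derivIter A (α + 1) = P.deriv (P.derivIter A α) := by
  simp [derivIter]

theorem derivIter_limit {α : Ordinal.{0}} (h : Order.IsSuccLimit α) :
    P.derivIter A α = ⋂ β : {β : Ordinal.{0} // β < α}, P.derivIter A β.1 := by
  unfold derivIter
  rw [Ordinal.limitRecOn_limit _ _ _ _ h]

end Iterates

section Transport

variable {X : Type} [TopologicalSpace X] (P : Presentation X) (f : X ≃ₜ X)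

/-- The presentation `P_f` obtained by pulling `P` back along a homeomorphism `f`. -/
def pullback : Presentation X where
  dist x y := P.dist (f x) (f y)
  seq i := f.symm (P.seq i)
  dist_self x := P.dist_self _
  eq_of_dist_eq_zero x y h := f.injective (P.eq_of_dist_eq_zero _ _ h)
  dist_comm x y := P.dist_comm _ _
  dist_triangle x y z := P.dist_triangle _ _ _
  isOpen_iff s := by
    rw [← f.symm.isOpen_preimage, P.isOpen_iff]
    constructor
    · intro h x hx
      obtain ⟨ε, hε, H⟩ := h (f x) (by simpa using hx)
      exact ⟨ε, hε, fun y hy => by simpa using H (f y) hy⟩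
    · intro h x hx
      obtain ⟨ε, hε, H⟩ := h (f.symm x) hx
      exact ⟨ε, hε, fun y hy => H (f.symm y) (by simpa using hy)⟩
  complete u hu := by
    obtain ⟨x, hx⟩ := P.complete (fun n => f (u n)) hu
    exact ⟨f.symm x, by simpa using hx⟩
  dense x ε hε := by simpa using P.dense (f x) ε hε

theorem ball_pullback (n : ℕ × ℕ) : (P.pullback f).ball n = f ⁻¹' P.ball n := by
  ext x; simp [ball, pullback]

theorem cball_pullback (n : ℕ × ℕ) : (P.pullback f).cball n = f ⁻¹' P.cball n := by
  ext x; simp [cball, pullback]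

theorem prec_pullback : (P.pullback f).prec = P.prec := by
  ext n m
  simp only [prec, ball_pullback, cball_pullback, f.surjective.preimage_subset_preimage_iff]

theorem apart_pullback : (P.pullback f).apart = P.apart := by
  ext n m
  simp only [apart, cball_pullback, ← preimage_inter, preimage_eq_empty_iff,
    f.surjective.range_eq, disjoint_univ]

theorem code_pullback (F : Set X) : (P.pullback f).code F = P.code (f '' F) := by
  ext n
  simp only [code, ball_pullback, mem_ofPred_eq]
  rw [← image_nonempty (f := f), image_preimage_inter]

theorem deriv_pullback : (P.pullback f).deriv = P.deriv := by
  ext A n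
  simp only [deriv, prec_pullback, apart_pullback]

theorem phi_pullback (F : Set X) : (P.pullback f).phi F = P.phi (f '' F) := by
  have : (P.pullback f).derivIter = P.derivIter := by
    unfold derivIter
    rw [deriv_pullback]
  unfold phi rankA
  rw [code_pullback, this]

end Transport

end Presentation

section Cylinder

theorem continuous_of_forall_cylinder {f : (ℕ → ℕ) → ℕ → ℕ}
    (h : ∀ x j, ∃ m, ∀ y, (∀ i < m, y i = x i) → f y j = f x j) : Continuous f := by
  refine continuous_pi fun j => continuous_iff_continuousAt.2 fun x => ?_
  obtain ⟨m, hm⟩ := h x j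
  have hx : ∀ᶠ y in 𝓝 x, ∀ i ∈ Finset.range m, y i = x i :=
    (Finset.eventually_all _).2 fun i _ =>
      (continuous_apply i).continuousAt.preimage_mem_nhds
        ((isOpen_discrete {x i}).mem_nhds rfl)
  refine (continuousAt_const (y := f x j)).congr ?_
  filter_upwards [hx] with y hy
  exact (hm y fun i hi => hy i (Finset.mem_range.2 hi)).symm

/-- `L` is the length function of a partition of Baire space into cylinders: the cell of `x`
is determined by `x ↾ L x`. -/
def IsCellLength (L : (ℕ → ℕ) → ℕ) : Prop :=
  ∀ x y : ℕ → ℕ, (∀ j < L x, y j = x j) → L y = L x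

/-- The points vanishing past the stem of their cell; there is exactly one in each cell. -/
def cellPoints (L : (ℕ → ℕ) → ℕ) : Set (ℕ → ℕ) := {x | ∀ j, L x ≤ j → x j = 0}

/-- The point of `cellPoints L` in the cell of `x`. -/
def cellPoint (L : (ℕ → ℕ) → ℕ) (x : ℕ → ℕ) : ℕ → ℕ := fun j => if j < L x then x j else 0

/-- What remains of `x` after removing the stem of its cell. -/
def cellTail (L : (ℕ → ℕ) → ℕ) (x : ℕ → ℕ) : ℕ → ℕ := fun j => x (L x + j)

/-- The point with tail `y` in the cell of `p`. -/
def graft (L : (ℕ → ℕ) → ℕ) (p y : ℕ → ℕ) : ℕ → ℕ := fun j => if j < L p then p j else y (j - L p)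

variable {L L' : (ℕ → ℕ) → ℕ}

theorem mem_cellPoints_iff {x : ℕ → ℕ} : x ∈ cellPoints L ↔ cellTail L x = 0 := by
  constructor
  · exact fun h => funext fun j => h _ (Nat.le_add_right _ _)
  · intro h j hj
    have := congrFun h (j - L x)
    simpa [cellTail, Nat.add_sub_cancel' hj] using this

theorem length_cellPoint (hL : IsCellLength L) (x : ℕ → ℕ) : L (cellPoint L x) = L x :=
  hL _ _ fun j hj => by simp [cellPoint, hj]

theorem cellPoint_mem (hL : IsCellLength L) (x : ℕ → ℕ) : cellPoint L x ∈ cellPoints L := by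
  intro j hj
  rw [length_cellPoint hL] at hj
  simp [cellPoint, hj]

theorem length_graft (hL : IsCellLength L) (p y : ℕ → ℕ) : L (graft L p y) = L p :=
  hL _ _ fun j hj => by simp [graft, hj]

theorem cellPoint_graft (hL : IsCellLength L) {p : ℕ → ℕ} (hp : p ∈ cellPoints L) (y : ℕ → ℕ) :
    cellPoint L (graft L p y) = p := by
  ext j
  by_cases hj : j < L p
  · simp [cellPoint, length_graft hL, graft, hj]
  · simp [cellPoint, length_graft hL, hj, hp j (not_lt.1 hj)]

theorem cellTail_graft (hL : IsCellLength L) (p y : ℕ → ℕ) : cellTail L (graft L p y) = y := by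
  ext j
  simp [cellTail, length_graft hL, graft]

theorem graft_cellPoint_cellTail (hL : IsCellLength L) (x : ℕ → ℕ) :
    graft L (cellPoint L x) (cellTail L x) = x := by
  ext j
  by_cases hj : j < L x
  · simp [cellPoint, length_cellPoint hL, graft, hj]
  · simp [cellTail, length_cellPoint hL, graft, hj, Nat.add_sub_cancel' (not_lt.1 hj)]

theorem continuous_cellTail (hL : IsCellLength L) : Continuous (cellTail L) := by
  refine continuous_of_forall_cylinder fun x j => ⟨L x + j + 1, fun y hy => ?_⟩
  have : L y = L x := hL x y fun i hi => hy i (by omega)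
  simp only [cellTail, this]
  exact hy _ (by omega)

theorem isClosed_cellPoints (hL : IsCellLength L) : IsClosed (cellPoints L) := by
  have : cellPoints L = cellTail L ⁻¹' {0} := by
    ext x
    exact mem_cellPoints_iff
  rw [this]
  exact isClosed_singleton.preimage (continuous_cellTail hL)

theorem countable_cellPoints (L : (ℕ → ℕ) → ℕ) : (cellPoints L).Countable := by
  refine (countable_range fun (l : List ℕ) (j : ℕ) => l.getD j 0).mono fun x hx => ?_
  refine ⟨(List.range (L x)).map x, funext fun j => ?_⟩
  by_cases hj : j < L x
  · simp [List.getD_eq_getElem?_getD, hj]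
  · simp [List.getD_eq_getElem?_getD, hj, hx j (not_lt.1 hj)]

/-- Move each cell of `L` onto the cell of `L'` prescribed by `σ`, keeping tails. -/
def cellMap (hL : IsCellLength L) (σ : cellPoints L → cellPoints L') (x : ℕ → ℕ) : ℕ → ℕ :=
  graft L' (σ ⟨cellPoint L x, cellPoint_mem hL x⟩) (cellTail L x)

theorem continuous_cellMap (hL : IsCellLength L) (σ : cellPoints L → cellPoints L') :
    Continuous (cellMap hL σ) := by
  refine continuous_of_forall_cylinder fun x j => ⟨L x + j + 1, fun y hy => ?_⟩
  have hlen : L y = L x := hL x y fun i hi => hy i (by omega)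
  have hpt : cellPoint L y = cellPoint L x := by
    ext i
    by_cases hi : i < L x
    · simp [cellPoint, hlen, hi, hy i (by omega)]
    · simp [cellPoint, hlen, hi]
  simp only [cellMap, hpt, graft, cellTail, hlen]
  split_ifs
  · rfl
  · exact hy _ (by omega)

theorem cellMap_cellMap (hL : IsCellLength L) (hL' : IsCellLength L')
    {σ : cellPoints L → cellPoints L'} {τ : cellPoints L' → cellPoints L}
    (h : Function.LeftInverse τ σ) (x : ℕ → ℕ) : cellMap hL' τ (cellMap hL σ x) = x := by
  have : (⟨cellPoint L' (cellMap hL σ x), cellPoint_mem hL' _⟩ : cellPoints L') =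
      σ ⟨cellPoint L x, cellPoint_mem hL x⟩ :=
    Subtype.ext (cellPoint_graft hL' (σ _).2 _)
  rw [cellMap, this, h, cellMap, cellTail_graft hL', graft_cellPoint_cellTail hL]

/-- The homeomorphism of Baire space induced by a bijection between the cells of two
partitions into cylinders. -/
def cellHomeomorph (hL : IsCellLength L) (hL' : IsCellLength L')
    (σ : cellPoints L ≃ cellPoints L') : (ℕ → ℕ) ≃ₜ (ℕ → ℕ) where
  toFun := cellMap hL σ
  invFun := cellMap hL' σ.symm
  left_inv := cellMap_cellMap hL hL' σ.left_inv
  right_inv := cellMap_cellMap hL' hL σ.right_inv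
  continuous_toFun := continuous_cellMap hL σ
  continuous_invFun := continuous_cellMap hL' σ.symm

theorem cellHomeomorph_image (hL : IsCellLength L) (hL' : IsCellLength L')
    (σ : cellPoints L ≃ cellPoints L') :
    cellHomeomorph hL hL' σ '' cellPoints L = cellPoints L' := by
  have h : cellHomeomorph hL hL' σ ⁻¹' cellPoints L' = cellPoints L := by
    ext x
    rw [mem_preimage, mem_cellPoints_iff, mem_cellPoints_iff]
    exact Eq.congr (cellTail_graft hL' _ _) rfl
  rw [← h, image_preimage_eq _ (cellHomeomorph hL hL' σ).surjective]

theorem exists_homeomorph_image_cellPoints (hL : IsCellLength L) (hL' : IsCellLength L')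
    (hi : (cellPoints L).Infinite) (hi' : (cellPoints L').Infinite) :
    ∃ f : (ℕ → ℕ) ≃ₜ (ℕ → ℕ), f '' cellPoints L = cellPoints L' := by
  have := hi.to_subtype
  have := hi'.to_subtype
  have := (countable_cellPoints L).to_subtype
  have := (countable_cellPoints L').to_subtype
  obtain ⟨σ⟩ := nonempty_equiv_of_countable (α := cellPoints L) (β := cellPoints L')
  exact ⟨_, cellHomeomorph_image hL hL' σ⟩

end Cylinder

section Descent

variable (e : ℕ → Ordinal.{0})

theorem exists_not_descent (x : ℕ → ℕ) : ∃ k, ¬ e (x (k + 1)) < e (x k) :=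
  WellFounded.not_rel_apply_succ (r := (· < ·)) fun k => e (x k)

open Classical in
/-- The length of the shortest initial segment of `x` whose labels under `e` fail to be
strictly decreasing. -/
noncomputable def descentLength (x : ℕ → ℕ) : ℕ := Nat.find (exists_not_descent e x) + 2

theorem lt_descentLength_iff {x : ℕ → ℕ} {l : ℕ} :
    l + 1 < descentLength e x ↔ ∀ k < l, e (x (k + 1)) < e (x k) := by
  classical
  rw [descentLength, Nat.add_lt_add_iff_right (k := 1) (n := l), Nat.lt_succ_iff, Nat.le_find_iff]
  simp

theorem isCellLength_descentLength : IsCellLength (descentLength e) := by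
  intro x y h
  have key : ∀ l, l + 1 < descentLength e x + 1 →
      (l + 1 < descentLength e y ↔ l + 1 < descentLength e x) := by
    intro l hl
    rw [lt_descentLength_iff, lt_descentLength_iff]
    exact forall₂_congr fun k hk => by rw [h k (by omega), h (k + 1) (by omega)]
  have h2 : 2 ≤ descentLength e x := Nat.le_add_left _ _
  have h2' : 2 ≤ descentLength e y := Nat.le_add_left _ _
  have h₁ := key (descentLength e x - 1) (by omega)
  have h₂ := key (descentLength e x - 2) (by omega)
  omega

theorem infinite_cellPoints_descentLength : (cellPoints (descentLength e)).Infinite := by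
  refine infinite_of_injective_forall_mem (f := fun a j : ℕ => if j = 1 then a else 0)
    (fun a b h => by simpa using congrFun h 1) fun a j hj => ?_
  have : 2 ≤ descentLength e fun j : ℕ => if j = 1 then a else 0 := Nat.le_add_left _ _
  exact if_neg (by omega)

end Descent

namespace Presentation

section Baire

variable {P : Presentation (ℕ → ℕ)}

theorem mem_code_iff (hP : P.dist = baireDist) {F : Set (ℕ → ℕ)} {n : ℕ × ℕ} :
    n ∈ P.code F ↔ ∃ z ∈ F, ∀ j < n.2 + 1, z j = P.seq n.1 j := by
  simp only [code, ball, hP, baireDist_lt_iff, Set.Nonempty, mem_inter_iff, mem_ofPred_eq, and_comm]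

theorem exists_seq_eq (hP : P.dist = baireDist) (z : ℕ → ℕ) (l : ℕ) :
    ∃ i, ∀ j < l + 1, P.seq i j = z j := by
  obtain ⟨i, hi⟩ := P.dense z ((1 / 2) ^ (l + 1)) (by positivity)
  rw [hP, baireDist_lt_iff] at hi
  exact ⟨i, fun j hj => (hi j hj).symm⟩

theorem prec_iff (hP : P.dist = baireDist) {n m : ℕ × ℕ} :
    P.prec n m ↔ n.2 < m.2 ∧ ∀ j < n.2 + 1, P.seq m.1 j = P.seq n.1 j := by
  simp only [prec, ball, cball, hP, baireDist_lt_iff, baireDist_le_iff, ofPred_subset_ofPred]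
  refine and_congr_right fun h => ⟨fun H => H _ fun _ _ => rfl, fun H z hz j hj => ?_⟩
  rw [hz j (by omega), H j hj]

theorem apart_iff (hP : P.dist = baireDist) {n m : ℕ × ℕ} :
    P.apart n m ↔ ∃ j, j < n.2 ∧ j < m.2 ∧ P.seq n.1 j ≠ P.seq m.1 j := by
  simp only [apart, cball, hP, baireDist_le_iff]
  constructor
  · intro h
    by_contra! H
    have : (fun j => if j < n.2 then P.seq n.1 j else P.seq m.1 j) ∈
        {x | ∀ j < n.2, x j = P.seq n.1 j} ∩ {x | ∀ j < m.2, x j = P.seq m.1 j} := by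
      refine ⟨fun j hj => if_pos hj, fun j hj => ?_⟩
      dsimp only
      split_ifs with h'
      · exact H j h' hj
      · rfl
    rw [h] at this
    exact this
  · rintro ⟨j, hn, hm, hne⟩
    rw [eq_empty_iff_forall_notMem]
    rintro x ⟨hx, hx'⟩
    exact hne ((hx j hn).symm.trans (hx' j hm))

theorem exists_seq_extending (hP : P.dist = baireDist) (n : ℕ × ℕ) (a c : ℕ) :
    ∃ i, (∀ j < n.2 + 1, P.seq i j = P.seq n.1 j) ∧ P.seq i (n.2 + 1) = a ∧
      P.seq i (n.2 + 2) = c := by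
  obtain ⟨i, hi⟩ := exists_seq_eq hP
    (fun j => if j < n.2 + 1 then P.seq n.1 j else if j = n.2 + 1 then a else c) (n.2 + 2)
  refine ⟨i, fun j hj => ?_, ?_, ?_⟩
  · rw [hi j (by omega), if_pos hj]
  · simp [hi (n.2 + 1)]
  · simp [hi (n.2 + 2)]

/-- Codes of the initial segments whose labels under `e` are strictly decreasing and end in a
label at least `2 * δ`. -/
def descentCode (P : Presentation (ℕ → ℕ)) (e : ℕ → Ordinal.{0}) (δ : Ordinal.{0}) :
    Set (ℕ × ℕ) :=
  {n | (∀ j < n.2, e (P.seq n.1 (j + 1)) < e (P.seq n.1 j)) ∧ 2 * δ ≤ e (P.seq n.1 n.2)}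

theorem deriv_code_cellPoints (hP : P.dist = baireDist) (e : ℕ → Ordinal.{0}) :
    P.deriv (P.code (cellPoints (descentLength e))) = P.descentCode e 0 := by
  ext n
  constructor
  · rintro ⟨-, u, hu, v, hv, hnu, hnv, huv⟩
    refine ⟨?_, by simp⟩
    rw [prec_iff hP] at hnu hnv
    rw [apart_iff hP] at huv
    rw [mem_code_iff hP] at hu hv
    obtain ⟨y, hyF, hy⟩ := hu
    obtain ⟨z, hzF, hz⟩ := hv
    obtain ⟨i, hiu, hiv, hi⟩ := huv
    have zero : ∀ {m : ℕ × ℕ} {x : ℕ → ℕ}, x ∈ cellPoints (descentLength e) → n.2 < m.2 →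
        (∀ j < n.2 + 1, P.seq m.1 j = P.seq n.1 j) → (∀ j < m.2 + 1, x j = P.seq m.1 j) →
        ¬ (∀ j < n.2, e (P.seq n.1 (j + 1)) < e (P.seq n.1 j)) →
        ∀ j, n.2 + 1 ≤ j → x j = 0 := by
      intro m x hx hlt hm hxm H j hj
      refine hx j (le_trans (not_lt.1 fun h => H ?_) hj)
      intro k hk
      have := (lt_descentLength_iff e).1 h k hk
      rwa [hxm k (by omega), hxm (k + 1) (by omega), hm k (by omega), hm (k + 1) (by omega)] at this
    by_contra H
    rcases lt_or_ge i (n.2 + 1) with h | h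
    · exact hi ((hnu.2 i h).trans (hnv.2 i h).symm)
    · rw [← hy i (by omega), ← hz i (by omega), zero hyF hnu.1 hnu.2 hy H i h,
        zero hzF hnv.1 hnv.2 hz H i h] at hi
      exact hi rfl
  · rintro ⟨hn, -⟩
    have key : ∀ i, (∀ j < n.2 + 1, P.seq i j = P.seq n.1 j) → P.seq i (n.2 + 2) = 0 →
        ∃ z ∈ cellPoints (descentLength e), ∀ j < n.2 + 2 + 1, z j = P.seq i j := by
      intro i hi h0
      refine ⟨fun j => if j < n.2 + 2 then P.seq i j else 0, fun j hj => if_neg fun h => ?_,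
        fun j hj => ?_⟩
      · refine (Nat.lt_of_lt_of_le ((lt_descentLength_iff e (l := n.2)).2 fun k hk => ?_) hj).not_ge
          (by omega)
        simp only [show k < n.2 + 2 by omega, show k + 1 < n.2 + 2 by omega, if_true,
          hi k (by omega), hi (k + 1) (by omega)]
        exact hn k hk
      · rcases Nat.lt_succ_iff_lt_or_eq.1 hj with h | rfl
        · exact if_pos h
        · simp [h0]
    obtain ⟨i, hi, hi1, hi2⟩ := exists_seq_extending hP n 0 0
    obtain ⟨k, hk, hk1, hk2⟩ := exists_seq_extending hP n 1 0
    refine ⟨?_, (i, n.2 + 2), (mem_code_iff hP).2 (key i hi hi2), (k, n.2 + 2),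
      (mem_code_iff hP).2 (key k hk hk2), (prec_iff hP).2 ⟨by simp, hi⟩,
      (prec_iff hP).2 ⟨by simp, hk⟩,
      (apart_iff hP).2 ⟨n.2 + 1, by simp, by simp, by simp [hi1, hk1]⟩⟩
    obtain ⟨z, hz, h⟩ := key i hi hi2
    exact (mem_code_iff hP).2 ⟨z, hz, fun j hj => by rw [h j (by omega), hi j hj]⟩

theorem two_mul_add_one (δ : Ordinal.{0}) : 2 * (δ + 1) = 2 * δ + 1 + 1 := by
  rw [mul_add, mul_one, add_assoc, one_add_one_eq_two]

theorem deriv_descentCode (hP : P.dist = baireDist) {e : ℕ → Ordinal.{0}} {γ : Ordinal.{0}}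
    (hlt : ∀ n, e n < γ) (hsurj : ∀ o < γ, ∃ a b, a ≠ b ∧ e a = o ∧ e b = o) (δ : Ordinal.{0}) :
    P.deriv (P.descentCode e δ) = P.descentCode e (δ + 1) := by
  ext n
  constructor
  · rintro ⟨hn, u, hu, v, -, hnu, hnv, huv⟩
    refine ⟨hn.1, ?_⟩
    rw [prec_iff hP] at hnu hnv
    obtain ⟨i, hiu, -, hi⟩ := (apart_iff hP).1 huv
    have hni : n.2 + 1 ≤ i := by
      by_contra h
      exact hi ((hnu.2 i (by omega)).trans (hnv.2 i (by omega)).symm)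
    have hdesc : ∀ j, n.2 + 1 ≤ j → j ≤ u.2 → e (P.seq u.1 j) ≤ e (P.seq u.1 (n.2 + 1)) := by
      intro j hj
      induction j, hj using Nat.le_induction with
      | base => exact fun _ => le_rfl
      | succ j hj ih => exact fun h => (hu.1 j (by omega)).le.trans (ih (by omega))
    rw [two_mul_add_one]
    refine Order.add_one_le_of_lt ?_
    have h₁ := hu.1 n.2 (by omega)
    rw [hnu.2 n.2 (by omega)] at h₁
    refine lt_of_le_of_lt (Order.add_one_le_of_lt ?_) h₁
    have h₂ := hu.1 (u.2 - 1) (by omega)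
    rw [Nat.sub_add_cancel (by omega)] at h₂
    exact (hu.2.trans_lt h₂).trans_le (hdesc _ (by omega) (by omega))
  · rintro ⟨hn, hle⟩
    rw [two_mul_add_one] at hle
    have h₁ : 2 * δ + 1 < e (P.seq n.1 n.2) := Order.add_one_le_iff.1 hle
    have h₀ : 2 * δ < 2 * δ + 1 := lt_add_one _
    obtain ⟨a, b, hab, ha, hb⟩ := hsurj _ (h₁.trans (hlt _))
    obtain ⟨c, -, -, hc, -⟩ := hsurj _ ((h₀.trans h₁).trans (hlt _))
    have key : ∀ i d, (∀ j < n.2 + 1, P.seq i j = P.seq n.1 j) → P.seq i (n.2 + 1) = d →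
        P.seq i (n.2 + 2) = c → e d = 2 * δ + 1 → (i, n.2 + 2) ∈ P.descentCode e δ := by
      intro i d hi hd hic hed
      refine ⟨fun j hj => ?_, by simp [hic, hc]⟩
      dsimp only at hj ⊢
      rcases lt_trichotomy j n.2 with h | rfl | h
      · rw [hi j (by omega), hi (j + 1) (by omega)]
        exact hn j h
      · rw [hd, hi _ (by omega), hed]
        exact h₁
      · obtain rfl : j = n.2 + 1 := by omega
        rw [hd, hed, hic, hc]
        exact h₀
    obtain ⟨i, hi, hi1, hi2⟩ := exists_seq_extending hP n a c
    obtain ⟨k, hk, hk1, hk2⟩ := exists_seq_extending hP n b c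
    exact ⟨⟨hn, (h₀.trans h₁).le⟩, (i, n.2 + 2), key i a hi hi1 hi2 ha, (k, n.2 + 2),
      key k b hk hk1 hk2 hb, (prec_iff hP).2 ⟨by simp, hi⟩, (prec_iff hP).2 ⟨by simp, hk⟩,
      (apart_iff hP).2 ⟨n.2 + 1, by simp, by simp, by simpa [hi1, hk1] using hab⟩⟩

theorem derivIter_code_cellPoints (hP : P.dist = baireDist) {e : ℕ → Ordinal.{0}} {γ : Ordinal.{0}}
    (hlt : ∀ n, e n < γ) (hsurj : ∀ o < γ, ∃ a b, a ≠ b ∧ e a = o ∧ e b = o) (δ : Ordinal.{0}) :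
    P.derivIter (P.code (cellPoints (descentLength e))) (1 + δ) = P.descentCode e δ := by
  induction δ using Ordinal.limitRecOn with
  | zero =>
    have := P.derivIter_add_one (P.code (cellPoints (descentLength e))) 0
    rw [zero_add, derivIter_zero, deriv_code_cellPoints hP] at this
    simpa using this
  | add_one δ ih =>
    rw [← add_assoc, derivIter_add_one, ih, deriv_descentCode hP hlt hsurj]
  | limit δ hδ ih =>
    rw [derivIter_limit _ _ (Ordinal.isSuccLimit_add 1 hδ)]
    have hmem : ∀ β < δ, 1 + β < 1 + δ := fun β hβ => by simpa using hβ
    ext n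
    simp only [mem_iInter, Subtype.forall]
    constructor
    · intro h
      have h' : ∀ β < δ, n ∈ P.descentCode e β := fun β hβ => ih β hβ ▸ h _ (hmem β hβ)
      refine ⟨(h' 0 hδ.bot_lt).1, ?_⟩
      rw [(Ordinal.isNormal_mul_right two_pos).le_iff_forall_le hδ]
      exact fun β hβ => (h' β hβ).2
    · intro h β hβ
      have h' : ∀ β' ≤ δ, n ∈ P.descentCode e β' := fun β' hβ' =>
        ⟨h.1, le_trans (mul_le_mul_right hβ' 2) h.2⟩
      rcases eq_or_ne β 0 with rfl | hβ0
      · have := h' 0 zero_le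
        rw [← deriv_code_cellPoints hP] at this
        rw [derivIter_zero]
        exact this.1
      · rw [← Ordinal.add_sub_cancel_of_le (Order.one_le_iff_ne_zero.2 hβ0)] at hβ ⊢
        have hlt' : β - 1 < δ := by simpa using hβ
        rw [ih _ hlt']
        exact h' _ hlt'.le

theorem phi_cellPoints (hP : P.dist = baireDist) {e : ℕ → Ordinal.{0}} {γ : Ordinal.{0}}
    (hlt : ∀ n, e n < 2 * γ) (hsurj : ∀ o < 2 * γ, ∃ a b, a ≠ b ∧ e a = o ∧ e b = o) :
    P.phi (cellPoints (descentLength e)) = 1 + γ := by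
  have hiter := derivIter_code_cellPoints hP hlt hsurj
  refine IsLeast.csInf_eq ⟨?_, fun β hβ => ?_⟩
  · have hempty : P.descentCode e γ = ∅ :=
      eq_empty_of_forall_notMem fun n hn => (hlt _).not_ge hn.2
    rw [mem_ofPred_eq, derivIter_add_one, hiter, hempty]
    exact eq_empty_of_forall_notMem fun n hn => hn.1
  · by_contra! h
    rw [mem_ofPred_eq] at hβ
    rcases eq_or_ne β 0 with rfl | hβ0
    · rw [derivIter_add_one, derivIter_zero, deriv_code_cellPoints hP] at hβ
      obtain ⟨i, hi⟩ := exists_seq_eq hP 0 1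
      have hmem : (i, 1) ∈ P.code (cellPoints (descentLength e)) :=
        (mem_code_iff hP).2 ⟨0, fun _ _ => rfl, fun j hj => (hi j hj).symm⟩
      rw [← hβ] at hmem
      have := hmem.1 0 (by simp)
      rw [hi 0 (by simp), hi (0 + 1) (by simp)] at this
      exact lt_irrefl _ this
    · rw [← Ordinal.add_sub_cancel_of_le (Order.one_le_iff_ne_zero.2 hβ0)] at hβ h
      generalize β - 1 = δ at hβ h
      have hδ : δ < γ := by simpa using h
      rw [add_assoc, hiter, hiter] at hβ
      obtain ⟨a, -, -, ha, -⟩ := hsurj (2 * δ) ((Ordinal.isNormal_mul_right two_pos).strictMono hδ)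
      obtain ⟨i, hi⟩ := exists_seq_eq hP (fun _ => a) 0
      have hmem : (i, 0) ∈ P.descentCode e δ :=
        ⟨fun j hj => absurd hj (Nat.not_lt_zero j), by simp [hi 0, ha]⟩
      rw [← hβ] at hmem
      have := hmem.2
      rw [hi 0 (by simp), ha] at this
      exact ((Ordinal.isNormal_mul_right two_pos).strictMono (lt_add_one δ)).not_ge this

end Baire

end Presentation

theorem Ordinal.exists_labelling {o : Ordinal.{0}} (h0 : o ≠ 0) (h : o.card ≤ Cardinal.aleph0) :
    ∃ e : ℕ → Ordinal.{0}, (∀ n, e n < o) ∧ ∀ β < o, ∃ a b, a ≠ b ∧ e a = β ∧ e b = β := by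
  have : Countable (Iio o) := by
    rw [← Cardinal.mk_le_aleph0_iff, Cardinal.mk_Iio_ordinal]
    simpa [← Ordinal.lift_card] using h
  have : Nonempty (Iio o) := ⟨⟨0, zero_lt_iff.2 h0⟩⟩
  obtain ⟨g, hg⟩ := exists_surjective_nat (Iio o)
  refine ⟨fun n => g (n / 2), fun n => (g _).2, fun β hβ => ?_⟩
  obtain ⟨k, hk⟩ := hg ⟨β, hβ⟩
  refine ⟨2 * k, 2 * k + 1, by omega, ?_, ?_⟩
  · simp [hk]
  · simp [show (2 * k + 1) / 2 = k by omega, hk]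

theorem Presentation.exists_phi_cellPoints_eq {P : Presentation (ℕ → ℕ)} (hP : P.dist = baireDist)
    {α : Ordinal.{0}} (hα : 2 ≤ α) (hc : α.card ≤ Cardinal.aleph0) :
    ∃ e : ℕ → Ordinal.{0}, P.phi (cellPoints (descentLength e)) = α := by
  have h1 : 1 + (α - 1) = α := Ordinal.add_sub_cancel_of_le (one_le_two.trans hα)
  have h0 : α - 1 ≠ 0 := by
    intro h
    rw [h, add_zero] at h1
    exact absurd (h1 ▸ hα) (by simp)
  have hc' : (2 * (α - 1)).card ≤ Cardinal.aleph0 := by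
    rw [Ordinal.card_mul]
    refine (mul_le_mul' ?_ ((Ordinal.card_le_card (Ordinal.sub_le_self α 1)).trans hc)).trans
      Cardinal.aleph0_mul_aleph0.le
    simp
  obtain ⟨e, hlt, hsurj⟩ := Ordinal.exists_labelling (by simpa using h0) hc'
  exact ⟨e, (phi_cellPoints hP hlt hsurj).trans h1⟩

/-- For any presentation `P` of Baire space with the standard ultrametric,
there is a countable closed `F` with `φ_P(F) = 2` such that for every countable ordinal
`α ≥ 2` there is a homeomorphism `f_α` with `φ_{P_{f_α}}(F) = α`. -/
theorem stmt15 (P : Presentation (ℕ → ℕ)) (hP : P.dist = baireDist) :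
    ∃ F : Set (ℕ → ℕ), IsClosed F ∧ F.Countable ∧ P.phi F = 2 ∧
      ∀ α : Ordinal.{0}, 2 ≤ α → α.card ≤ Cardinal.aleph0 →
        ∃ f : (ℕ → ℕ) ≃ₜ (ℕ → ℕ), ∃ Q : Presentation (ℕ → ℕ),
          Q.dist = (fun x y => P.dist (f x) (f y)) ∧
          Q.seq = (fun i => f.symm (P.seq i)) ∧
          Q.phi F = α := by
  obtain ⟨e₀, he₀⟩ := Presentation.exists_phi_cellPoints_eq hP le_rfl (by simp)
  refine ⟨cellPoints (descentLength e₀), isClosed_cellPoints (isCellLength_descentLength e₀),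
    countable_cellPoints _, he₀, fun α hα hc => ?_⟩
  obtain ⟨e, he⟩ := Presentation.exists_phi_cellPoints_eq hP hα hc
  obtain ⟨f, hf⟩ := exists_homeomorph_image_cellPoints (isCellLength_descentLength e₀)
    (isCellLength_descentLength e) (infinite_cellPoints_descentLength e₀)
    (infinite_cellPoints_descentLength e)
  exact ⟨f, P.pullback f, rfl, rfl, by rw [P.phi_pullback, hf, he]⟩
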